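/- arXiv:0710.1278 — 2 statements merged into one kernel-verified Lean document; each statement's English description precedes it below -/
import Mathlib

section
/- Let A be a matrix representation of dimension n⃗ of a quiver Q with vertices 1,…,t over 𝔽 (ℝ or ℂ). For each subset Γ of Υ_{n⃗}, the deformation U_Γ(ε⃗) := A + Σ_{(α,i,j)∈Γ} ε_{αij} E_{αij} (with independent parameters ε_{αij}) is miniversal if and only if the vector space R(n⃗,𝔽) decomposes into the direct sum R(n⃗,𝔽) = [𝔽^{n⃗×n⃗}, A] ⊕ E_Γ, where E_Γ is the subspace spanned by the elementary representations E_{αij} with (α,i,j) ∈ Γ. -/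
open Matrix Filter Pointwise

/-- The space of matrix representations of a quiver with vertex set `V`,
arrow set `Arrow` (an arrow `α` goes from `src α` to `tgt α`), where the
vector space attached to the vertex `v` has basis indexed by `N v`:
the representation assigns to each arrow `α` a matrix in `𝔽^{N (tgt α) × N (src α)}`. -/
abbrev QRep (V Arrow : Type) (src tgt : Arrow → V) (N : V → Type) (𝔽 : Type) : Type :=
  ∀ α : Arrow, Matrix (N (tgt α)) (N (src α)) 𝔽

/-- The index set `Υ` of triples `(α, i, j)`. -/
abbrev QIdx (V Arrow : Type) (src tgt : Arrow → V) (N : V → Type) : Type :=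
  Σ α : Arrow, N (tgt α) × N (src α)

variable {V Arrow : Type} {src tgt : Arrow → V} {N : V → Type} {𝔽 : Type} [RCLike 𝔽]

/-- `D` is a deformation of `A`: a family of representations, depending on
parameters `λ : ι → 𝔽`, whose matrix entries are analytic (= given by convergent
power series) in a neighbourhood of `0`, with `D 0 = A`. -/
def IsDeformation {ι : Type} [Fintype ι]
    (A : QRep V Arrow src tgt N 𝔽) (D : (ι → 𝔽) → QRep V Arrow src tgt N 𝔽) : Prop :=
  D 0 = A ∧ ∀ α i j, AnalyticAt 𝔽 (fun lam => D lam α i j) (0 : ι → 𝔽)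

/-- Equivalence of deformations: `E` is obtained from `D` by an analytic family
of isomorphisms `I v lam` with `I v 0 = 1`. -/
def DefEquiv [∀ v, Fintype (N v)] [∀ v, DecidableEq (N v)] {ι : Type} [Fintype ι]
    (D E : (ι → 𝔽) → QRep V Arrow src tgt N 𝔽) : Prop :=
  ∃ I : ∀ v : V, (ι → 𝔽) → Matrix (N v) (N v) 𝔽,
    (∀ v, I v 0 = 1) ∧
    (∀ v i j, AnalyticAt 𝔽 (fun lam => I v lam i j) (0 : ι → 𝔽)) ∧
    ∀ α, ∀ᶠ lam in nhds (0 : ι → 𝔽),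
      E lam α = I (tgt α) lam * D lam α * (I (src α) lam)⁻¹

/-- A deformation `D` of `A` is versal if every deformation `B` of `A` is
equivalent to a deformation of the form `D ∘ φ` with `φ` analytic, `φ 0 = 0`. -/
def IsVersal [∀ v, Fintype (N v)] [∀ v, DecidableEq (N v)] {ι : Type} [Fintype ι]
    (A : QRep V Arrow src tgt N 𝔽) (D : (ι → 𝔽) → QRep V Arrow src tgt N 𝔽) : Prop :=
  IsDeformation A D ∧
  ∀ (l : ℕ) (B : (Fin l → 𝔽) → QRep V Arrow src tgt N 𝔽), IsDeformation A B →
    ∃ φ : (Fin l → 𝔽) → ι → 𝔽,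
      φ 0 = 0 ∧ (∀ i : ι, AnalyticAt 𝔽 (fun mu => φ mu i) (0 : Fin l → 𝔽)) ∧
      DefEquiv (fun mu => D (φ mu)) B

/-- A deformation is miniversal if it is versal and no versal deformation has
fewer parameters. -/
def IsMiniversal [∀ v, Fintype (N v)] [∀ v, DecidableEq (N v)] {ι : Type} [Fintype ι]
    (A : QRep V Arrow src tgt N 𝔽) (D : (ι → 𝔽) → QRep V Arrow src tgt N 𝔽) : Prop :=
  IsVersal A D ∧
  ∀ (l : ℕ) (B : (Fin l → 𝔽) → QRep V Arrow src tgt N 𝔽),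
    IsVersal A B → Fintype.card ι ≤ l

/-- The elementary representation `E_{αij}`: all matrices are `0` except the one
assigned to `α`, whose `(i,j)` entry is `1`. -/
def elemRep [DecidableEq Arrow] [∀ v, DecidableEq (N v)]
    (x : QIdx V Arrow src tgt N) : QRep V Arrow src tgt N 𝔽 :=
  fun α i j => if (⟨α, (i, j)⟩ : QIdx V Arrow src tgt N) = x then 1 else 0

/-- The subspace `[𝔽^{n×n}, A]` of representations of the form
`α ↦ C (tgt α) * A α − A α * C (src α)`. -/
def bracketSet [∀ v, Fintype (N v)] (A : QRep V Arrow src tgt N 𝔽) :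
    Set (QRep V Arrow src tgt N 𝔽) :=
  {R | ∃ C : ∀ v : V, Matrix (N v) (N v) 𝔽,
    ∀ α, R α = C (tgt α) * A α - A α * C (src α)}

/-- `E_Γ`: the subspace spanned by the elementary representations `E_{αij}`
with `(α,i,j) ∈ Γ`. -/
def eGamma [DecidableEq Arrow] [∀ v, DecidableEq (N v)]
    (Γ : Finset (QIdx V Arrow src tgt N)) : Set (QRep V Arrow src tgt N 𝔽) :=
  (Submodule.span 𝔽 ((elemRep (𝔽 := 𝔽)) '' (↑Γ : Set (QIdx V Arrow src tgt N))) :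
    Submodule 𝔽 (QRep V Arrow src tgt N 𝔽))

open scoped ContDiff

attribute [local instance] Matrix.normedAddCommGroup Matrix.normedSpace

/-- The linear map `C ↦ [C, A]`. -/
def bracketMap [∀ v, Fintype (N v)] (A : QRep V Arrow src tgt N 𝔽) :
    (∀ v, Matrix (N v) (N v) 𝔽) →ₗ[𝔽] QRep V Arrow src tgt N 𝔽 where
  toFun C := fun α => C (tgt α) * A α - A α * C (src α)
  map_add' C C' := by
    ext1 α
    simp only [Pi.add_apply, Matrix.add_mul, Matrix.mul_add]
    abel
  map_smul' c C := by
    ext1 α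
    simp [smul_sub]

theorem coe_range_bracketMap [∀ v, Fintype (N v)] (A : QRep V Arrow src tgt N 𝔽) :
    ((LinearMap.range (bracketMap A) : Submodule 𝔽 (QRep V Arrow src tgt N 𝔽)) :
      Set (QRep V Arrow src tgt N 𝔽)) = bracketSet A := by
  ext R
  constructor
  · rintro ⟨C, rfl⟩
    exact ⟨C, fun _ => rfl⟩
  · rintro ⟨C, hC⟩
    exact ⟨C, funext fun α => (hC α).symm⟩

theorem analyticAt_qRep [Fintype Arrow] [∀ v, Fintype (N v)] {E : Type*} [NormedAddCommGroup E]
    [NormedSpace 𝔽 E] {D : E → QRep V Arrow src tgt N 𝔽} {x : E}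
    (h : ∀ α i j, AnalyticAt 𝔽 (fun y => D y α i j) x) : AnalyticAt 𝔽 D x :=
  AnalyticAt.pi fun α => AnalyticAt.pi fun i => AnalyticAt.pi fun j => h α i j

theorem AnalyticAt.linearMap_comp {E F G : Type*} [NormedAddCommGroup E] [NormedSpace 𝔽 E]
    [NormedAddCommGroup F] [NormedSpace 𝔽 F] [FiniteDimensional 𝔽 F]
    [NormedAddCommGroup G] [NormedSpace 𝔽 G] (L : F →ₗ[𝔽] G) {f : E → F} {x : E}
    (hf : AnalyticAt 𝔽 f x) : AnalyticAt 𝔽 (fun y => L (f y)) x :=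
  (L.toContinuousLinearMap.analyticAt (f x)).comp hf

theorem ContDiff.of_linearMap {F G : Type*}
    [NormedAddCommGroup F] [NormedSpace 𝔽 F] [FiniteDimensional 𝔽 F]
    [NormedAddCommGroup G] [NormedSpace 𝔽 G] (L : F →ₗ[𝔽] G) {n : WithTop ℕ∞} :
    ContDiff 𝔽 n fun x => L x :=
  L.toContinuousLinearMap.contDiff

theorem eventually_isUnit_of_eq_one {m X : Type*} [Fintype m] [DecidableEq m] [TopologicalSpace X]
    {I : X → Matrix m m 𝔽} {x : X} (h1 : I x = 1) (hI : ∀ i j, ContinuousAt (fun y => I y i j) x) :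
    ∀ᶠ y in nhds x, IsUnit (I y).det := by
  have hc : ContinuousAt I x := continuousAt_pi.2 fun i => continuousAt_pi.2 fun j => hI i j
  have hd : ContinuousAt (fun y => (I y).det) x :=
    (continuous_id.matrix_det.continuousAt (x := I x)).comp hc
  have h0 : (I x).det ≠ 0 := by simp [h1]
  filter_upwards [hd.eventually_ne h0] with y hy using isUnit_iff_ne_zero.2 hy

theorem hasDerivAt_matrix_mul_apply {l m n : Type*} [Fintype m]
    {P : 𝔽 → Matrix l m 𝔽} {Q : 𝔽 → Matrix m n 𝔽} {P' : Matrix l m 𝔽} {Q' : Matrix m n 𝔽} {x : 𝔽}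
    (hP : ∀ i j, HasDerivAt (fun y => P y i j) (P' i j) x)
    (hQ : ∀ i j, HasDerivAt (fun y => Q y i j) (Q' i j) x) (i : l) (j : n) :
    HasDerivAt (fun y => (P y * Q y) i j) ((P' * Q x + P x * Q') i j) x := by
  simp only [Matrix.mul_apply, Matrix.add_apply, ← Finset.sum_add_distrib]
  exact HasDerivAt.fun_sum fun k _ => (hP i k).mul (hQ k j)

theorem IsDeformation.add_linearMap {ι : Type} [Fintype ι] (A : QRep V Arrow src tgt N 𝔽)
    (s : (ι → 𝔽) →ₗ[𝔽] QRep V Arrow src tgt N 𝔽) : IsDeformation A fun ε => A + s ε := by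
  refine ⟨by simp, fun α i j => analyticAt_const.add ?_⟩
  let p : QRep V Arrow src tgt N 𝔽 →ₗ[𝔽] 𝔽 :=
    { toFun := fun R => R α i j, map_add' := fun _ _ => rfl, map_smul' := fun _ _ => rfl }
  exact AnalyticAt.linearMap_comp (p ∘ₗ s) analyticAt_id

/-- An analytic equation `f (x, y) = 0` with `∂f/∂y = -1` at `(a, 0)`, the latter expressed along
lines, can be solved analytically for `y`. -/
theorem exists_analyticAt_of_line_expansion {E : Type*} [NormedAddCommGroup E] [NormedSpace 𝔽 E]
    [FiniteDimensional 𝔽 E] {f : E × E → E} {a : E} {r : E → E} (hf : ContDiffAt 𝔽 ω f (a, 0))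
    (hfa : f (a, 0) = 0) (hline : ∀ y (c : 𝔽), f (a, c • y) = c • (-y) - c ^ 2 • r y) :
    ∃ ψ : E → E, AnalyticAt 𝔽 ψ a ∧ ψ a = 0 ∧ ∀ᶠ x in nhds a, f (x, ψ x) = 0 := by
  have : CompleteSpace E := FiniteDimensional.complete 𝔽 E
  have hfd : fderiv 𝔽 f (a, 0) ∘L .inr 𝔽 E E = -ContinuousLinearMap.id 𝔽 E := by
    ext1 y
    have hc : HasDerivAt (fun c : 𝔽 => (a, c • y)) (0, y) 0 := by
      simpa using (hasDerivAt_const (0 : 𝔽) a).prodMk ((hasDerivAt_id (0 : 𝔽)).smul_const y)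
    have h1 : HasDerivAt (fun c : 𝔽 => f (a, c • y)) (fderiv 𝔽 f (a, 0) (0, y)) 0 := by
      refine HasFDerivAt.comp_hasDerivAt (f := fun c : 𝔽 => (a, c • y)) (0 : 𝔽) ?_ hc
      rw [zero_smul]
      exact (hf.differentiableAt (by simp)).hasFDerivAt
    have h2 : HasDerivAt (fun c : 𝔽 => f (a, c • y)) (-y) 0 := by
      simp only [hline]
      simpa using ((hasDerivAt_id (0 : 𝔽)).smul_const (-y)).fun_sub
        (((hasDerivAt_id (0 : 𝔽)).fun_pow 2).smul_const (r y))
    exact h1.unique h2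
  have hinv : (fderiv 𝔽 f (a, 0) ∘L .inr 𝔽 E E).IsInvertible :=
    ⟨ContinuousLinearEquiv.neg 𝔽, by rw [hfd]; rfl⟩
  refine ⟨hf.implicitFunction (by simp) hinv,
    (hf.contDiffAt_implicitFunction (by simp) hinv).analyticAt,
    hf.implicitFunction_apply_self (by simp) hinv, ?_⟩
  filter_upwards [hf.eventually_apply_implicitFunction (by simp) hinv] with x hx
  rw [hx, hfa]

section Versal

variable [Fintype Arrow] [∀ v, Fintype (N v)] [∀ v, DecidableEq (N v)]
  {ι : Type} [Fintype ι]

theorem range_bracketMap_sup_range_eq_top_of_isVersal {A : QRep V Arrow src tgt N 𝔽}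
    {D : (ι → 𝔽) → QRep V Arrow src tgt N 𝔽} {s : (ι → 𝔽) →L[𝔽] QRep V Arrow src tgt N 𝔽}
    (hs : HasFDerivAt D s 0) (hD : IsVersal A D) :
    LinearMap.range (bracketMap A) ⊔ LinearMap.range (s : (ι → 𝔽) →ₗ[𝔽] _) = ⊤ := by
  rw [eq_top_iff]
  intro R _
  obtain ⟨⟨hD0, -⟩, hD⟩ := hD
  obtain ⟨φ, hφ0, hφ, I, hI0, hI, hE⟩ := hD 1 (fun μ => A + μ 0 • R)
    ⟨by simp, fun α i j => by
      have h : AnalyticAt 𝔽 (fun μ : Fin 1 → 𝔽 => μ 0) 0 :=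
        (ContinuousLinearMap.proj (R := 𝔽) (φ := fun _ : Fin 1 => 𝔽) 0).analyticAt 0
      exact analyticAt_const.add (h.mul analyticAt_const)⟩
  let γ : 𝔽 → Fin 1 → 𝔽 := fun y _ => y
  have hγ0 : γ 0 = 0 := rfl
  have hγ : HasDerivAt γ (fun _ => 1) 0 := hasDerivAt_pi.2 fun _ => hasDerivAt_id _
  have along {f : (Fin 1 → 𝔽) → 𝔽} (hf : AnalyticAt 𝔽 f 0) :
      HasDerivAt (fun y => f (γ y)) (fderiv 𝔽 f 0 fun _ => 1) 0 :=
    hf.differentiableAt.hasFDerivAt.comp_hasDerivAt (0 : 𝔽) hγ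
  let C : ∀ v, Matrix (N v) (N v) 𝔽 := fun v i j => fderiv 𝔽 (fun μ => I v μ i j) 0 fun _ => 1
  have hC v i j : HasDerivAt (fun y => I v (γ y) i j) (C v i j) 0 := along (hI v i j)
  let e : ι → 𝔽 := fun x => fderiv 𝔽 (fun μ => φ μ x) 0 fun _ => 1
  have he : HasDerivAt (fun y => φ (γ y)) e 0 := hasDerivAt_pi.2 fun x => along (hφ x)
  have hDφ : HasDerivAt (fun y => D (φ (γ y))) (s e) 0 := by
    refine HasFDerivAt.comp_hasDerivAt (0 : 𝔽) ?_ he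
    rw [hγ0, hφ0]
    exact hs
  have hDφ' α i j : HasDerivAt (fun y => D (φ (γ y)) α i j) (s e α i j) 0 :=
    hasDerivAt_pi.1 (hasDerivAt_pi.1 (hasDerivAt_pi.1 hDφ α) i) j
  have key : R = bracketMap A C + s e := by
    ext α i j
    have hl := hasDerivAt_matrix_mul_apply (x := (0 : 𝔽)) (P := fun y => A α + y • R α) (P' := R α)
      (fun i j => by
        simpa using ((hasDerivAt_id (0 : 𝔽)).mul_const (R α i j)).const_add (A α i j))
      (hC (src α)) i j
    have hr := hasDerivAt_matrix_mul_apply (hC (tgt α)) (hDφ' α) i j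
    have hev : (fun y => (I (tgt α) (γ y) * D (φ (γ y)) α) i j) =ᶠ[nhds 0]
        fun y => ((A α + y • R α) * I (src α) (γ y)) i j := by
      have h1 := hγ.continuousAt.eventually (hE α)
      have h2 := hγ.continuousAt.eventually (eventually_isUnit_of_eq_one (hI0 (src α))
        fun i j => (hI (src α) i j).continuousAt)
      filter_upwards [h1, h2] with y h1 h2
      have h3 : A α + y • R α = I (tgt α) (γ y) * D (φ (γ y)) α * (I (src α) (γ y))⁻¹ := h1
      rw [h3, Matrix.nonsing_inv_mul_cancel_right _ _ h2]
    have := hl.unique (hr.congr_of_eventuallyEq hev.symm)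
    simp only [hγ0, hφ0, hI0, hD0, zero_smul, add_zero, Matrix.mul_one, Matrix.one_mul,
      Matrix.add_apply] at this
    simp only [bracketMap, LinearMap.coe_mk, AddHom.coe_mk, Pi.add_apply, Matrix.add_apply,
      Matrix.sub_apply]
    linear_combination this
  rw [key]
  exact Submodule.add_mem_sup ⟨C, rfl⟩ ⟨e, rfl⟩

theorem finrank_le_of_isVersal {A : QRep V Arrow src tgt N 𝔽}
    {D : (ι → 𝔽) → QRep V Arrow src tgt N 𝔽} (hD : IsVersal A D) :
    Module.finrank 𝔽 (QRep V Arrow src tgt N 𝔽) ≤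
      Module.finrank 𝔽 (LinearMap.range (bracketMap A)) + Fintype.card ι := by
  have h := range_bracketMap_sup_range_eq_top_of_isVersal
    (analyticAt_qRep hD.1.2).differentiableAt.hasFDerivAt hD
  rw [← finrank_top, ← h]
  refine (Submodule.finrank_add_le_finrank_add_finrank _ _).trans (Nat.add_le_add_left ?_ _)
  exact (LinearMap.finrank_range_le _).trans_eq (Module.finrank_fintype_fun_eq_card 𝔽)

variable [Fintype V]

/-- The local equation `X (1 + C_p) = (1 + C_q) (A + s ε)` can be solved analytically for `(C, ε)`
when `(C, ε) ↦ [C, A] + s ε` is onto. -/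
theorem exists_analyticAt_conjugation {A : QRep V Arrow src tgt N 𝔽}
    {s : (ι → 𝔽) →ₗ[𝔽] QRep V Arrow src tgt N 𝔽}
    (h : LinearMap.range (bracketMap A) ⊔ LinearMap.range s = ⊤) :
    ∃ g : QRep V Arrow src tgt N 𝔽 → (∀ v, Matrix (N v) (N v) 𝔽) × (ι → 𝔽),
      AnalyticAt 𝔽 g A ∧ g A = 0 ∧ ∀ᶠ X in nhds A, ∀ α,
        X α * (1 + (g X).1 (src α)) = (1 + (g X).1 (tgt α)) * (A α + s (g X).2 α) := by
  obtain ⟨S, hS⟩ := ((bracketMap A).coprod s).exists_rightInverse_of_surjective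
    (by rw [LinearMap.range_coprod, h])
  let f : QRep V Arrow src tgt N 𝔽 × QRep V Arrow src tgt N 𝔽 → QRep V Arrow src tgt N 𝔽 :=
    fun z α => z.1 α * (1 + (S z.2).1 (src α)) - (1 + (S z.2).1 (tgt α)) * (A α + s (S z.2).2 α)
  have hf : ContDiff 𝔽 ω f := by
    refine contDiff_pi.2 fun α => contDiff_pi.2 fun i => contDiff_pi.2 fun j => ?_
    have h1 i j : ContDiff 𝔽 ω
        fun z : QRep V Arrow src tgt N 𝔽 × QRep V Arrow src tgt N 𝔽 => z.1 α i j :=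
      ContDiff.of_linearMap (𝔽 := 𝔽)
        { toFun := fun z : QRep V Arrow src tgt N 𝔽 × QRep V Arrow src tgt N 𝔽 => z.1 α i j
          map_add' := fun _ _ => rfl, map_smul' := fun _ _ => rfl }
    have h2 v i j : ContDiff 𝔽 ω
        fun z : QRep V Arrow src tgt N 𝔽 × QRep V Arrow src tgt N 𝔽 => (S z.2).1 v i j :=
      ContDiff.of_linearMap (𝔽 := 𝔽)
        { toFun := fun z : QRep V Arrow src tgt N 𝔽 × QRep V Arrow src tgt N 𝔽 => (S z.2).1 v i j
          map_add' := fun _ _ => by simp, map_smul' := fun _ _ => by simp }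
    have h3 i j : ContDiff 𝔽 ω
        fun z : QRep V Arrow src tgt N 𝔽 × QRep V Arrow src tgt N 𝔽 => s (S z.2).2 α i j :=
      ContDiff.of_linearMap (𝔽 := 𝔽)
        { toFun := fun z : QRep V Arrow src tgt N 𝔽 × QRep V Arrow src tgt N 𝔽 => s (S z.2).2 α i j
          map_add' := fun _ _ => by simp, map_smul' := fun _ _ => by simp }
    simp only [f, Matrix.sub_apply, Matrix.mul_apply, Matrix.add_apply]
    exact (ContDiff.sum fun k _ => (h1 i k).mul (contDiff_const.add (h2 _ k j))).sub
      (ContDiff.sum fun k _ => (contDiff_const.add (h2 _ i k)).mul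
        (contDiff_const.add (h3 k j)))
  have hfA : f (A, 0) = 0 := by
    ext1 α
    simp [f]
  have hline (y : QRep V Arrow src tgt N 𝔽) (r : 𝔽) :
      f (A, r • y) = r • (-y) - r ^ 2 • fun α => (S y).1 (tgt α) * s (S y).2 α := by
    have hy := congrFun (LinearMap.congr_fun hS y)
    ext1 α
    have hyα : (S y).1 (tgt α) * A α - A α * (S y).1 (src α) + s (S y).2 α = y α := hy α
    simp only [f, map_smul, Prod.smul_fst, Prod.smul_snd, Pi.smul_apply, Pi.sub_apply,
      Pi.neg_apply, ← hyα, Matrix.mul_add, Matrix.add_mul, Matrix.mul_one, Matrix.one_mul,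
      Matrix.mul_smul, Matrix.smul_mul, smul_add, smul_sub, smul_neg, pow_two, mul_smul, neg_add,
      neg_sub]
    abel
  obtain ⟨ψ, hψ, hψA, hψX⟩ := exists_analyticAt_of_line_expansion hf.contDiffAt hfA hline
  refine ⟨fun X => S (ψ X), hψ.linearMap_comp S, by simp [hψA], ?_⟩
  filter_upwards [hψX] with X hX α
  exact sub_eq_zero.1 (congrFun hX α)

theorem isVersal_add_linearMap {A : QRep V Arrow src tgt N 𝔽}
    {s : (ι → 𝔽) →ₗ[𝔽] QRep V Arrow src tgt N 𝔽}
    (h : LinearMap.range (bracketMap A) ⊔ LinearMap.range s = ⊤) :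
    IsVersal A fun ε => A + s ε := by
  refine ⟨.add_linearMap A s, fun l B ⟨hB0, hB⟩ => ?_⟩
  obtain ⟨g, hg, hgA, hgX⟩ := exists_analyticAt_conjugation h
  have hBan : AnalyticAt 𝔽 B 0 := analyticAt_qRep hB
  have hgB : AnalyticAt 𝔽 (fun μ => g (B μ)) 0 :=
    AnalyticAt.comp (g := g) (by rwa [hB0]) hBan
  have hI v i j : AnalyticAt 𝔽 (fun μ => (1 + (g (B μ)).1 v : Matrix _ _ 𝔽) i j) 0 := by
    refine analyticAt_const.add (AnalyticAt.linearMap_comp (𝔽 := 𝔽)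
      { toFun := fun z : (∀ v, Matrix (N v) (N v) 𝔽) × (ι → 𝔽) => z.1 v i j
        map_add' := fun _ _ => rfl, map_smul' := fun _ _ => rfl } hgB)
  have hI0 v : (1 + (g (B 0)).1 v : Matrix _ _ 𝔽) = 1 := by simp [hB0, hgA]
  refine ⟨fun μ => (g (B μ)).2, by simp [hB0, hgA], fun x => ?_,
    fun v μ => 1 + (g (B μ)).1 v, hI0, hI, fun α => ?_⟩
  · exact AnalyticAt.linearMap_comp (𝔽 := 𝔽)
      { toFun := fun z : (∀ v, Matrix (N v) (N v) 𝔽) × (ι → 𝔽) => z.2 x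
        map_add' := fun _ _ => rfl, map_smul' := fun _ _ => rfl } hgB
  · have hBc : Tendsto B (nhds 0) (nhds A) := hB0 ▸ hBan.continuousAt
    filter_upwards [hBc.eventually hgX, eventually_isUnit_of_eq_one (hI0 (src α))
      fun i j => (hI (src α) i j).continuousAt] with μ h1 h2
    rw [Pi.add_apply, ← h1 α, Matrix.mul_nonsing_inv_cancel_right _ _ h2]

theorem isVersal_add_linearMap_iff {A : QRep V Arrow src tgt N 𝔽}
    {s : (ι → 𝔽) →ₗ[𝔽] QRep V Arrow src tgt N 𝔽} :
    IsVersal A (fun ε => A + s ε) ↔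
      LinearMap.range (bracketMap A) ⊔ LinearMap.range s = ⊤ := by
  refine ⟨fun h => ?_, isVersal_add_linearMap⟩
  have hd : HasFDerivAt (fun ε => A + s ε) s.toContinuousLinearMap 0 :=
    HasFDerivAt.const_add A s.toContinuousLinearMap.hasFDerivAt
  have := range_bracketMap_sup_range_eq_top_of_isVersal hd h
  rwa [LinearMap.coe_toContinuousLinearMap] at this

theorem exists_isVersal (A : QRep V Arrow src tgt N 𝔽) :
    ∃ (l : ℕ) (D : (Fin l → 𝔽) → QRep V Arrow src tgt N 𝔽), IsVersal A D ∧
      Module.finrank 𝔽 (LinearMap.range (bracketMap A)) + l =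
        Module.finrank 𝔽 (QRep V Arrow src tgt N 𝔽) := by
  obtain ⟨W, hW⟩ := (LinearMap.range (bracketMap A)).exists_isCompl
  let s := W.subtype ∘ₗ (Module.finBasis 𝔽 W).equivFun.symm.toLinearMap
  have hs : LinearMap.range s = W := by
    rw [LinearMap.range_comp, LinearEquiv.range, Submodule.map_top, Submodule.range_subtype]
  exact ⟨_, fun ε => A + s ε, isVersal_add_linearMap (by rw [hs, hW.sup_eq_top]),
    Submodule.finrank_add_eq_of_isCompl hW⟩

end Versal

section Elementary

variable [DecidableEq Arrow] [∀ v, DecidableEq (N v)]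

theorem linearIndependent_elemRep :
    LinearIndependent 𝔽
      (elemRep (𝔽 := 𝔽) : QIdx V Arrow src tgt N → QRep V Arrow src tgt N 𝔽) := by
  rw [linearIndependent_iff']
  intro Γ c hc x hx
  have := congrFun (congrFun (congrFun hc x.1) x.2.1) x.2.2
  simpa [elemRep, Finset.sum_apply, Matrix.sum_apply, hx] using this

theorem range_linearCombination_elemRep (Γ : Finset (QIdx V Arrow src tgt N)) :
    LinearMap.range (Fintype.linearCombination 𝔽
      fun x : Γ => (elemRep x.1 : QRep V Arrow src tgt N 𝔽)) =
      Submodule.span 𝔽 (elemRep (𝔽 := 𝔽) '' (Γ : Set (QIdx V Arrow src tgt N))) := by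
  rw [Fintype.range_linearCombination, Set.image_eq_range]
  rfl

theorem finrank_span_elemRep (Γ : Finset (QIdx V Arrow src tgt N)) :
    Module.finrank 𝔽 (Submodule.span 𝔽
      (elemRep (𝔽 := 𝔽) '' (Γ : Set (QIdx V Arrow src tgt N)))) = Fintype.card Γ := by
  have := finrank_span_eq_card (linearIndependent_elemRep.comp (R := 𝔽) (fun x : Γ => x.1)
    Subtype.val_injective)
  rw [Set.image_eq_range]
  exact this

end Elementary

/-- **Theorem 3.** For a representation `A` of dimension `n⃗` of a quiver `Q` with
vertices `1,…,t` over `𝔽 = ℝ` or `ℂ`, and a subset `Γ ⊆ Υ_{n⃗}`, the deformation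
`U_Γ(ε) = A + ∑_{(α,i,j)∈Γ} ε_{αij} E_{αij}` is miniversal if and only if
`R(n⃗,𝔽) = [𝔽^{n⃗×n⃗}, A] ⊕ E_Γ`. -/
theorem simplest_miniversal_iff_direct_sum
    {t : ℕ} {Arrow : Type} [Fintype Arrow] [DecidableEq Arrow]
    {src tgt : Arrow → Fin t} {N : Fin t → Type}
    [∀ v, Fintype (N v)] [∀ v, DecidableEq (N v)]
    {𝔽 : Type} [RCLike 𝔽]
    (A : QRep (Fin t) Arrow src tgt N 𝔽)
    (Γ : Finset (QIdx (Fin t) Arrow src tgt N))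
    (UΓ : (↥Γ → 𝔽) → QRep (Fin t) Arrow src tgt N 𝔽)
    (hUΓ : UΓ = fun ε => A + ∑ x : ↥Γ, ε x • elemRep (x : QIdx (Fin t) Arrow src tgt N)) :
    IsMiniversal A UΓ ↔
      (bracketSet A ∩ eGamma (𝔽 := 𝔽) Γ = {0} ∧
        bracketSet A + eGamma (𝔽 := 𝔽) Γ = Set.univ) := by
  set T := LinearMap.range (bracketMap A) with hT
  set W := Submodule.span 𝔽 (elemRep (𝔽 := 𝔽) '' (Γ : Set (QIdx (Fin t) Arrow src tgt N))) with hW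
  obtain ⟨s, hsW, rfl⟩ : ∃ s : (Γ → 𝔽) →ₗ[𝔽] QRep (Fin t) Arrow src tgt N 𝔽,
      LinearMap.range s = W ∧ UΓ = fun ε => A + s ε :=
    ⟨Fintype.linearCombination 𝔽 fun x : Γ => elemRep x.1, range_linearCombination_elemRep Γ, hUΓ⟩
  have hversal : IsVersal A (fun ε => A + s ε) ↔ T ⊔ W = ⊤ := by
    rw [isVersal_add_linearMap_iff, hsW]
  have hTW : Module.finrank 𝔽 T + Fintype.card Γ =
      Module.finrank 𝔽 ↥(T ⊔ W) + Module.finrank 𝔽 ↥(T ⊓ W) := by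
    rw [Submodule.finrank_sup_add_finrank_inf_eq, finrank_span_elemRep]
  have hiff : (bracketSet A ∩ eGamma (𝔽 := 𝔽) Γ = {0} ∧
      bracketSet A + eGamma (𝔽 := 𝔽) Γ = Set.univ) ↔ T ⊓ W = ⊥ ∧ T ⊔ W = ⊤ := by
    rw [← coe_range_bracketMap, eGamma, ← hT, ← hW, ← Submodule.coe_inf, ← Submodule.coe_sup,
      ← Submodule.bot_coe (R := 𝔽), ← Submodule.top_coe (R := 𝔽), SetLike.coe_set_eq,
      SetLike.coe_set_eq]
  rw [hiff]
  constructor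
  · rintro ⟨hv, hmin⟩
    have htop := hversal.1 hv
    obtain ⟨l, D, hD, hl⟩ := exists_isVersal A
    rw [← hT] at hl
    have := hmin l D hD
    rw [htop, finrank_top] at hTW
    exact ⟨Submodule.finrank_eq_zero.1 (by omega), htop⟩
  · rintro ⟨hbot, htop⟩
    rw [htop, hbot, finrank_top, finrank_bot] at hTW
    refine ⟨hversal.2 htop, fun l B hB => ?_⟩
    have := finrank_le_of_isVersal hB
    rw [Fintype.card_fin, ← hT] at this
    omega
end

section
/- Let Q be the quiver 1 — 2 — ⋯ — t with an arbitrary orientation of its arrows, over 𝔽 (ℝ or ℂ), and let L_{pq} and L_{rs} (with p ≤ r) be two of its indecomposable representations of the standard form. Then every miniversal deformation of A = L_{pq} ⊕ L_{rs} has at most one parameter. -/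
open Matrix Filter Pointwise

variable {V Arrow : Type} {src tgt : Arrow → V} {N : V → Type} {𝔽 : Type} [RCLike 𝔽]

section Chain

variable {t : ℕ}

/-- The endpoint `i` of the arrow `α_i` of the chain quiver `1 — 2 — ⋯ — t`
(vertices are numbered `0, …, t-1` here). -/
def chainLow (i : Fin (t - 1)) : Fin t := ⟨i.1, by have := i.isLt; omega⟩

/-- The endpoint `i+1` of the arrow `α_i` of the chain quiver. -/
def chainHigh (i : Fin (t - 1)) : Fin t := ⟨i.1 + 1, by have := i.isLt; omega⟩

/-- The source of the arrow `α_i`, for the orientation `o` (`o i = true` means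
`α_i : i → i+1`, and `o i = false` means `α_i : i+1 → i`). -/
def chainSrc (o : Fin (t - 1) → Bool) (i : Fin (t - 1)) : Fin t :=
  if o i then chainLow i else chainHigh i

/-- The target of the arrow `α_i`, for the orientation `o`. -/
def chainTgt (o : Fin (t - 1) → Bool) (i : Fin (t - 1)) : Fin t :=
  if o i then chainHigh i else chainLow i

/-- The dimension vector of the indecomposable representation `L_{ab}`:
`1` at the vertices `a, …, b` and `0` elsewhere. -/
def Ldim (a b : ℕ) (v : Fin t) : ℕ := if a ≤ v.1 ∧ v.1 ≤ b then 1 else 0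

/-- The indecomposable representation `L_{ab}` of the chain quiver: the `1×1` identity
matrix on every arrow joining two vertices of `{a, …, b}`, and zero matrices (with `0`
rows and/or `0` columns, hence with no entries at all) on all other arrows. -/
def Lrep (a b : ℕ) (o : Fin (t - 1) → Bool) (𝔽 : Type) [RCLike 𝔽] :
    QRep (Fin t) (Fin (t - 1)) (chainSrc o) (chainTgt o) (fun v => Fin (Ldim a b v)) 𝔽 :=
  fun _ => Matrix.of fun _ _ => 1

end Chain

section Versal

open scoped ContDiff Topology

/-- Implicit function theorem for an analytic equation `f (x, y) = 0` whose derivative `T` in the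
unknown `y` is merely surjective, with finite-dimensional target. -/
theorem exists_analytic_solution {𝕜 E F G : Type*} [RCLike 𝕜]
    [NormedAddCommGroup E] [NormedSpace 𝕜 E] [CompleteSpace E]
    [NormedAddCommGroup F] [NormedSpace 𝕜 F]
    [NormedAddCommGroup G] [NormedSpace 𝕜 G] [FiniteDimensional 𝕜 G]
    {f : E × F → G} (hf : ContDiff 𝕜 ω f) {a : E} (h0 : f (a, 0) = 0) {T : F →L[𝕜] G}
    (hT : HasFDerivAt (fun y => f (a, y)) T 0) (hsurj : Function.Surjective T) :
    ∃ g : E → F, g a = 0 ∧ AnalyticAt 𝕜 g a ∧ ∀ᶠ x in 𝓝 a, f (x, g x) = 0 := by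
  have : CompleteSpace G := FiniteDimensional.complete 𝕜 G
  obtain ⟨S, hS⟩ := T.toLinearMap.exists_rightInverse_of_surjective (LinearMap.range_eq_top.2 hsurj)
  let S' := LinearMap.toContinuousLinearMap S
  have hTS : T ∘L S' = .id 𝕜 G := ContinuousLinearMap.ext fun y => LinearMap.congr_fun hS y
  let h : E × G → G := fun z => f (z.1, S' z.2)
  have hh : ContDiff 𝕜 ω h := hf.comp (contDiff_fst.prodMk (S'.contDiff.comp contDiff_snd))
  have hinr : fderiv 𝕜 h (a, 0) ∘L .inr 𝕜 E G = .id 𝕜 G := by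
    refine (((hh.differentiable (by simp)).differentiableAt.hasFDerivAt).comp 0
      (hasFDerivAt_prodMk_right a 0)).unique ?_
    rw [← hTS]
    refine HasFDerivAt.comp (0 : G) (g := fun y => f (a, y)) ?_ S'.hasFDerivAt
    rwa [map_zero]
  have hinv : (fderiv 𝕜 h (a, 0) ∘L .inr 𝕜 E G).IsInvertible := by
    rw [hinr]
    exact ⟨.refl 𝕜 G, rfl⟩
  have hha : ContDiffAt 𝕜 ω h (a, 0) := hh.contDiffAt
  have hω : ω ≠ 0 := by simp
  refine ⟨fun x => S' (hha.implicitFunction hω hinv x), ?_, ?_, ?_⟩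
  · have : hha.implicitFunction hω hinv a = 0 := hha.implicitFunction_apply_self hω hinv
    simp only [this, map_zero]
  · exact (S'.contDiff.contDiffAt.comp a
      (hha.contDiffAt_implicitFunction hω hinv)).analyticAt
  · filter_upwards [hha.eventually_apply_implicitFunction hω hinv] with x hx
    exact hx.trans (by simp only [h, map_zero, h0])

/-- The families of entries of representations: the same data as `QRep`, but carrying the
sup norm. -/
abbrev QEntries (src tgt : Arrow → V) (N : V → Type) (𝔽 : Type) : Type :=
  ∀ α : Arrow, N (tgt α) → N (src α) → 𝔽

variable [∀ v, Fintype (N v)] {ι : Type} [Fintype ι]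

/-- The linearisation at the identity and at the parameter `0` of the action of the base change
group on the affine family `A + ∑ l, c l • E l`. -/
def infinitesimalAction (A : QEntries src tgt N 𝔽) (E : ι → QEntries src tgt N 𝔽) :
    ((∀ v, N v → N v → 𝔽) × (ι → 𝔽)) →ₗ[𝔽] QEntries src tgt N 𝔽 where
  toFun x α i j := ∑ k, x.1 (tgt α) i k * A α k j - ∑ k, A α i k * x.1 (src α) k j
    + ∑ l, x.2 l * E l α i j
  map_add' x y := by
    ext α i j
    simp only [Pi.add_apply, Prod.fst_add, Prod.snd_add, add_mul, mul_add,
      Finset.sum_add_distrib]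
    ring
  map_smul' a x := by
    ext α i j
    simp only [Pi.smul_apply, Prod.smul_fst, Prod.smul_snd, smul_eq_mul, RingHom.id_apply,
      mul_assoc, mul_left_comm _ a, ← Finset.mul_sum]
    ring

variable [∀ v, DecidableEq (N v)]

/-- The obstruction for the base change `1 + x.1` to carry `A + ∑ l, x.2 l • E l` to `R`. -/
def baseChangeDefect (A : QEntries src tgt N 𝔽) (E : ι → QEntries src tgt N 𝔽)
    (R : QEntries src tgt N 𝔽) (x : (∀ v, N v → N v → 𝔽) × (ι → 𝔽)) : QEntries src tgt N 𝔽 :=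
  fun α => of.symm ((1 + of (x.1 (tgt α))) * (of (A α) + ∑ l, x.2 l • of (E l α)) -
    of (R α) * (1 + of (x.1 (src α))))

theorem baseChangeDefect_self (A : QEntries src tgt N 𝔽) (E : ι → QEntries src tgt N 𝔽)
    (x : (∀ v, N v → N v → 𝔽) × (ι → 𝔽)) :
    baseChangeDefect A E A x = fun α i j => infinitesimalAction A E x α i j +
      ∑ k, x.1 (tgt α) i k * ∑ l, x.2 l * E l α k j := by
  ext α i j
  simp only [baseChangeDefect, infinitesimalAction, LinearMap.coe_mk, AddHom.coe_mk,
    Matrix.add_mul, Matrix.mul_add, Matrix.one_mul, Matrix.mul_one, of_symm_apply, Matrix.sub_apply, Matrix.add_apply]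
  simp only [Matrix.mul_apply, of_apply, Matrix.sum_apply, Matrix.smul_apply, smul_eq_mul]
  ring

variable [Fintype V] [Fintype Arrow]

theorem contDiff_baseChangeDefect (A : QEntries src tgt N 𝔽) (E : ι → QEntries src tgt N 𝔽) :
    ContDiff 𝔽 ω fun z : QEntries src tgt N 𝔽 × ((∀ v, N v → N v → 𝔽) × (ι → 𝔽)) =>
      baseChangeDefect A E z.1 z.2 := by
  refine contDiff_pi.2 fun α => contDiff_pi.2 fun i => contDiff_pi.2 fun j => ?_
  simp only [baseChangeDefect, Matrix.sub_apply, Matrix.mul_apply, Matrix.add_apply,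
    Matrix.sum_apply, Matrix.smul_apply, of_apply, of_symm_apply, smul_eq_mul]
  have hC : ∀ v i j, ContDiff 𝔽 ω
      fun z : QEntries src tgt N 𝔽 × ((∀ v, N v → N v → 𝔽) × (ι → 𝔽)) => z.2.1 v i j :=
    fun v i j => contDiff_pi.1 (contDiff_pi.1 (contDiff_pi.1 contDiff_snd.fst v) i) j
  have hc : ∀ l, ContDiff 𝔽 ω
      fun z : QEntries src tgt N 𝔽 × ((∀ v, N v → N v → 𝔽) × (ι → 𝔽)) => z.2.2 l :=
    fun l => contDiff_pi.1 contDiff_snd.snd l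
  have hR : ∀ k, ContDiff 𝔽 ω
      fun z : QEntries src tgt N 𝔽 × ((∀ v, N v → N v → 𝔽) × (ι → 𝔽)) => z.1 α i k :=
    fun k => contDiff_pi.1 (contDiff_pi.1 (contDiff_pi.1 contDiff_fst α) i) k
  exact (ContDiff.sum fun k _ => (contDiff_const.add (hC _ i k)).mul
    (contDiff_const.add (ContDiff.sum fun l _ => (hc l).mul contDiff_const))).sub
    (ContDiff.sum fun k _ => (hR k).mul (contDiff_const.add (hC _ k j)))

theorem hasFDerivAt_baseChangeDefect_self (A : QEntries src tgt N 𝔽)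
    (E : ι → QEntries src tgt N 𝔽) :
    HasFDerivAt (baseChangeDefect A E A)
      (LinearMap.toContinuousLinearMap (infinitesimalAction A E)) 0 := by
  rw [funext (baseChangeDefect_self A E)]
  refine hasFDerivAt_pi'' fun α => hasFDerivAt_pi'' fun i => hasFDerivAt_pi'' fun j => ?_
  have hT : HasFDerivAt (infinitesimalAction A E)
      (LinearMap.toContinuousLinearMap (infinitesimalAction A E)) 0 :=
    (LinearMap.toContinuousLinearMap (infinitesimalAction A E)).hasFDerivAt
  have hlin := hasFDerivAt_pi'.1 (hasFDerivAt_pi'.1 (hasFDerivAt_pi'.1 hT α) i) j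
  have hC : ∀ k, DifferentiableAt 𝔽
      (fun x : (∀ v, N v → N v → 𝔽) × (ι → 𝔽) => x.1 (tgt α) i k) 0 := fun k =>
    differentiableAt_pi.1 (differentiableAt_pi.1 (differentiableAt_pi.1 differentiableAt_fst _) i) k
  have hc : ∀ k, DifferentiableAt 𝔽
      (fun x : (∀ v, N v → N v → 𝔽) × (ι → 𝔽) => ∑ l, x.2 l * E l α k j) 0 := fun k =>
    .fun_sum fun l _ => (differentiableAt_pi.1 differentiableAt_snd l).mul_const _
  have hquad : HasFDerivAt (fun x : (∀ v, N v → N v → 𝔽) × (ι → 𝔽) =>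
      ∑ k, x.1 (tgt α) i k * ∑ l, x.2 l * E l α k j)
      (0 : ((∀ v, N v → N v → 𝔽) × (ι → 𝔽)) →L[𝔽] 𝔽) 0 := by
    rw [← Finset.sum_const_zero (s := (Finset.univ : Finset (N (tgt α))))]
    refine HasFDerivAt.fun_sum fun k _ => ?_
    exact ((hC k).hasFDerivAt.mul (hc k).hasFDerivAt).congr_fderiv
      (ContinuousLinearMap.ext fun _ => by simp)
  have := hlin.add hquad
  rw [add_zero] at this
  exact this

/-- If the affine family `A + ∑ l, c l • E l` is transversal at `A` to the orbit of `A`,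
then it is a versal deformation. -/
theorem isVersal_of_surjective_infinitesimalAction (A : QRep V Arrow src tgt N 𝔽)
    (E : ι → QRep V Arrow src tgt N 𝔽)
    (hE : Function.Surjective (infinitesimalAction A E)) :
    IsVersal A (fun c α => A α + ∑ l, c l • E l α) := by
  obtain ⟨A, rfl⟩ : ∃ A' : QEntries src tgt N 𝔽, (fun α => of (A' α)) = A := ⟨A, rfl⟩
  obtain ⟨E, rfl⟩ : ∃ E' : ι → QEntries src tgt N 𝔽, (fun l α => of (E' l α)) = E := ⟨E, rfl⟩
  obtain ⟨g, hg0, hg, hgeq⟩ := exists_analytic_solution (contDiff_baseChangeDefect A E)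
    (a := A) (by simp [baseChangeDefect_self]; rfl) (hasFDerivAt_baseChangeDefect_self A E) hE
  refine ⟨⟨?_, fun α i j => ?_⟩, fun l B hB => ?_⟩
  · ext α i j
    simp
  · simp only [Matrix.add_apply, Matrix.sum_apply, Matrix.smul_apply, smul_eq_mul]
    refine ContDiffAt.analyticAt (ContDiff.contDiffAt ?_)
    exact contDiff_const.add (by fun_prop)
  obtain ⟨B, rfl⟩ : ∃ B' : (Fin l → 𝔽) → QEntries src tgt N 𝔽, (fun mu α => of (B' mu α)) = B :=
    ⟨B, rfl⟩
  have hB0 : B 0 = A := hB.1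
  have hBan : AnalyticAt 𝔽 B 0 :=
    analyticAt_pi_iff.2 fun α => analyticAt_pi_iff.2 fun i => analyticAt_pi_iff.2 fun j =>
      hB.2 α i j
  have hgB : AnalyticAt 𝔽 (fun mu => g (B mu)) 0 :=
    AnalyticAt.fun_comp (by rwa [hB0]) hBan
  have hgB0 : g (B 0) = 0 := by rw [hB0, hg0]
  have hC : ∀ v i j, AnalyticAt 𝔽 (fun mu => (1 + of ((g (B mu)).1 v)) i j) 0 := by
    intro v i j
    simp only [Matrix.add_apply, of_apply]
    exact analyticAt_const.add (analyticAt_pi_iff.1 (analyticAt_pi_iff.1 (analyticAt_pi_iff.1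
      (analyticAt_fst.fun_comp hgB) v) i) j)
  refine ⟨fun mu => (g (B mu)).2, by simp [hgB0],
    fun i => analyticAt_pi_iff.1 (analyticAt_snd.fun_comp hgB) i,
    fun v mu => 1 + of ((g (B mu)).1 v), fun v => ?_, hC, fun α => ?_⟩
  · ext i j
    simp [hgB0]
  · have hdet : ∀ᶠ mu in 𝓝 (0 : Fin l → 𝔽), (1 + of ((g (B mu)).1 (src α))).det ≠ 0 := by
      refine ContinuousAt.eventually_ne
        (continuous_id.matrix_det.continuousAt.comp ?_) ?_
      · exact continuousAt_pi.2 fun i => continuousAt_pi.2 fun j => (hC (src α) i j).continuousAt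
      · have : (1 + of ((g (B 0)).1 (src α))) = 1 := by
          ext i j
          simp [hgB0]
        simp [this]
    have hlim : Tendsto B (𝓝 0) (𝓝 A) :=
      hB0 ▸ hBan.continuousAt.tendsto
    filter_upwards [hdet, hlim.eventually hgeq] with mu hmu hR
    have h : (1 + of ((g (B mu)).1 (tgt α))) * (of (A α) + ∑ l, (g (B mu)).2 l • of (E l α)) =
        of (B mu α) * (1 + of ((g (B mu)).1 (src α))) := sub_eq_zero.1 (congrFun hR α)
    rw [h]
    exact (Matrix.mul_nonsing_inv_cancel_right _ _ (isUnit_iff_ne_zero.2 hmu)).symm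

end Versal

section ChainSum

variable {t : ℕ}

/-- The equations attached to the arrows of a chain whose right endpoint has coefficient `1`
can be solved successively from left to right. -/
theorem exists_chain_solution (o : Fin (t - 1) → Bool) (f g : Fin t → 𝔽) (ρ : Fin (t - 1) → 𝔽) :
    ∃ c : Fin t → 𝔽, ∀ i,
      (o i = true → c (chainHigh i) - f (chainLow i) * c (chainLow i) = ρ i) ∧
      (o i = false → g (chainLow i) * c (chainLow i) - c (chainHigh i) = ρ i) := by
  let u : ℕ → 𝔽 := fun n => n.rec 0 fun n c =>
    if h : n < t - 1 then
      if o ⟨n, h⟩ then ρ ⟨n, h⟩ + f (chainLow ⟨n, h⟩) * c else g (chainLow ⟨n, h⟩) * c - ρ ⟨n, h⟩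
    else 0
  have hu : ∀ i : Fin (t - 1), u (i + 1) =
      if o i then ρ i + f (chainLow i) * u i else g (chainLow i) * u i - ρ i := fun i =>
    dif_pos i.isLt
  refine ⟨fun v => u v, fun i => ⟨fun h => ?_, fun h => ?_⟩⟩ <;>
  · simp only [chainHigh, hu, h, if_true, Bool.false_eq_true, if_false]
    simp [chainLow]

variable (p q r s : ℕ)

/-- The dimension at `v` of the first (`x = true`) or second (`x = false`) summand of
`L_{pq} ⊕ L_{rs}`. -/
def summandDim (x : Bool) (v : Fin t) : ℕ := if x then Ldim p q v else Ldim r s v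

variable {p q r s}

theorem summandDim_isLeft {v : Fin t} (a : Fin (Ldim p q v) ⊕ Fin (Ldim r s v)) :
    summandDim p q r s a.isLeft v = 1 := by
  have hL : ∀ {x y : ℕ}, 0 < Ldim x y v → Ldim x y v = 1 := by
    intro x y h
    unfold Ldim at *
    split_ifs at * <;> simp_all
  rcases a with a | a <;> exact hL a.pos

theorem eq_of_isLeft_eq {v : Fin t} {a b : Fin (Ldim p q v) ⊕ Fin (Ldim r s v)}
    (h : a.isLeft = b.isLeft) : a = b := by
  have ha := summandDim_isLeft a
  rcases a with a | a <;> rcases b with b | b <;> simp_all [summandDim] <;> ext <;> omega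

/-- The sum over a basis vector at `v` of a function of the summand it belongs to. -/
theorem sum_isLeft {v : Fin t} (F : Bool → 𝔽) :
    ∑ a : Fin (Ldim p q v) ⊕ Fin (Ldim r s v), F a.isLeft =
      ∑ x, summandDim p q r s x v * F x := by
  simp [summandDim]

/-- An entry of the arrow `i` between the summands `x` (at the target) and `y` (at the source) not
both of which reach the right endpoint of `i` has a unique position. -/
theorem eq_of_summandDim_chainHigh_eq_zero {o : Fin (t - 1) → Bool} {i : Fin (t - 1)}
    {x y : Bool} (hx : summandDim p q r s x (chainTgt o i) = 1)
    (hy : summandDim p q r s y (chainSrc o i) = 1)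
    (h : summandDim p q r s x (chainHigh i) * summandDim p q r s y (chainHigh i) = 0) :
    (i : ℕ) = min q s ∧ x = (o i == decide (s < q)) ∧ y = !x := by
  cases ho : o i <;> cases x <;> cases y <;>
    simp [summandDim, Ldim, chainTgt, chainSrc, ho, chainHigh, chainLow] at * <;> omega


/-- The representation with an entry `1` at every position between summands not both of which
reach the right endpoint of the arrow, and `0` elsewhere. -/
def boundaryRep (p q r s : ℕ) (o : Fin (t - 1) → Bool) (𝔽 : Type) [RCLike 𝔽] :
    QEntries (chainSrc o) (chainTgt o) (fun v => Fin (Ldim p q v) ⊕ Fin (Ldim r s v)) 𝔽 :=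
  fun i a b => if summandDim p q r s a.isLeft (chainHigh i) *
    summandDim p q r s b.isLeft (chainHigh i) = 0 then 1 else 0

theorem fromBlocks_Lrep_apply (o : Fin (t - 1) → Bool) (i : Fin (t - 1))
    (a : Fin (Ldim p q (chainTgt o i)) ⊕ Fin (Ldim r s (chainTgt o i)))
    (b : Fin (Ldim p q (chainSrc o i)) ⊕ Fin (Ldim r s (chainSrc o i))) :
    fromBlocks (Lrep p q o 𝔽 i) 0 0 (Lrep r s o 𝔽 i) a b =
      if a.isLeft = b.isLeft then 1 else 0 := by
  rcases a with a | a <;> rcases b with b | b <;> simp [Lrep]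

theorem infinitesimalAction_sum_apply (o : Fin (t - 1) → Bool) (c : Bool → Bool → Fin t → 𝔽)
    (m : 𝔽) (i : Fin (t - 1))
    (a : Fin (Ldim p q (chainTgt o i)) ⊕ Fin (Ldim r s (chainTgt o i)))
    (b : Fin (Ldim p q (chainSrc o i)) ⊕ Fin (Ldim r s (chainSrc o i))) :
    infinitesimalAction (ι := Fin 1) (src := chainSrc o) (tgt := chainTgt o)
        (fun i => of.symm (fromBlocks (Lrep p q o 𝔽 i) 0 0 (Lrep r s o 𝔽 i)))
        (fun _ => boundaryRep p q r s o 𝔽)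
        (fun v a b => c a.isLeft b.isLeft v, fun _ => m) i a b =
      summandDim p q r s b.isLeft (chainTgt o i) * c a.isLeft b.isLeft (chainTgt o i) -
        summandDim p q r s a.isLeft (chainSrc o i) * c a.isLeft b.isLeft (chainSrc o i) +
        m * boundaryRep p q r s o 𝔽 i a b := by
  simp only [infinitesimalAction, LinearMap.coe_mk, AddHom.coe_mk, of_symm_apply,
    fromBlocks_Lrep_apply, Fin.sum_univ_one]
  rw [sum_isLeft fun x => c a.isLeft x (chainTgt o i) * if x = b.isLeft then (1 : 𝔽) else 0,
    sum_isLeft fun x => (if a.isLeft = x then (1 : 𝔽) else 0) * c x b.isLeft (chainSrc o i)]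
  generalize a.isLeft = x, b.isLeft = y
  cases x <;> cases y <;> simp

theorem surjective_infinitesimalAction_sum (o : Fin (t - 1) → Bool) :
    Function.Surjective (infinitesimalAction (ι := Fin 1) (src := chainSrc o) (tgt := chainTgt o)
      (fun i => of.symm (fromBlocks (Lrep p q o 𝔽 i) 0 0 (Lrep r s o 𝔽 i)))
      (fun _ => boundaryRep p q r s o 𝔽)) := by
  intro R
  let ρ : Bool → Bool → Fin (t - 1) → 𝔽 := fun x y i =>
    ∑ a, ∑ b, if a.isLeft = x ∧ b.isLeft = y then R i a b else 0
  have hρ : ∀ i a b, R i a b = ρ a.isLeft b.isLeft i := by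
    intro i a b
    simp only [ρ]
    rw [Finset.sum_eq_single a, Finset.sum_eq_single b]
    · simp
    · exact fun b' _ hb => if_neg fun h => hb (eq_of_isLeft_eq h.2)
    · simp
    · exact fun a' _ ha => Finset.sum_eq_zero fun b' _ => if_neg fun h => ha (eq_of_isLeft_eq h.1)
    · simp
  choose c hc using fun x y => exists_chain_solution o
    (fun v => (summandDim p q r s x v : 𝔽)) (fun v => (summandDim p q r s y v : 𝔽)) (ρ x y)
  let res : Bool → Bool → Fin (t - 1) → 𝔽 := fun x y i => ρ x y i -
    (summandDim p q r s y (chainTgt o i) * c x y (chainTgt o i) -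
      summandDim p q r s x (chainSrc o i) * c x y (chainSrc o i))
  have hres : ∀ i x y, summandDim p q r s x (chainHigh i) = 1 →
      summandDim p q r s y (chainHigh i) = 1 → res x y i = 0 := by
    intro i x y hx hy
    simp only [res]
    cases ho : o i
    · simp [chainTgt, chainSrc, ho, hx, ← (hc x y i).2 ho]
    · simp [chainTgt, chainSrc, ho, hy, ← (hc x y i).1 ho]
  let m : 𝔽 := ∑ i : Fin (t - 1), if (i : ℕ) = min q s then
    res (o i == decide (s < q)) (!(o i == decide (s < q))) i else 0
  refine ⟨(fun v a b => c a.isLeft b.isLeft v, fun _ => m), ?_⟩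
  ext i a b
  rw [infinitesimalAction_sum_apply, hρ, ← sub_eq_zero, ← neg_eq_zero]
  suffices res a.isLeft b.isLeft i = m * boundaryRep p q r s o 𝔽 i a b by
    linear_combination this
  have ha := summandDim_isLeft a
  have hb := summandDim_isLeft b
  simp only [boundaryRep]
  split_ifs with h
  · obtain ⟨hi, hx, hy⟩ := eq_of_summandDim_chainHigh_eq_zero ha hb h
    simp only [m, mul_one]
    rw [Finset.sum_eq_single i, if_pos hi, hy, hx]
    · exact fun j _ hj => if_neg fun h => hj (Fin.ext (h.trans hi.symm))
    · simp
  · rw [mul_zero]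
    have hle : ∀ x, summandDim p q r s x (chainHigh i) ≤ 1 := by
      intro x
      simp only [summandDim, Ldim]
      split_ifs <;> simp
    have ⟨h1, h2⟩ := mul_ne_zero_iff.1 h
    have := hle a.isLeft
    have := hle b.isLeft
    exact hres i _ _ (by omega) (by omega)

end ChainSum

/-- **Theorem 6 (first part).** For the chain quiver `1 — 2 — ⋯ — t` with an arbitrary
orientation `o` of its arrows, over `𝔽 = ℝ` or `ℂ`, every miniversal deformation of a
direct sum `A = L_{pq} ⊕ L_{rs}` (`p ≤ r`) of two indecomposable representations has at
most one parameter. (Vertices are numbered `0, …, t-1`.) -/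
theorem miniversal_of_sum_of_two_indecomposables_le_one_param
    {t : ℕ} (o : Fin (t - 1) → Bool) {𝔽 : Type} [RCLike 𝔽]
    (p q r s : ℕ) (hpq : p ≤ q) (hq : q < t) (hrs : r ≤ s) (hs : s < t) (hpr : p ≤ r)
    (A : QRep (Fin t) (Fin (t - 1)) (chainSrc o) (chainTgt o)
      (fun v => Fin (Ldim p q v) ⊕ Fin (Ldim r s v)) 𝔽)
    (hA : A = fun α => Matrix.fromBlocks (Lrep p q o 𝔽 α) 0 0 (Lrep r s o 𝔽 α)) :
    ∀ (k : ℕ) (B : (Fin k → 𝔽) → QRep (Fin t) (Fin (t - 1)) (chainSrc o) (chainTgt o)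
        (fun v => Fin (Ldim p q v) ⊕ Fin (Ldim r s v)) 𝔽),
      IsMiniversal A B → k ≤ 1 := by
  intro k B hB
  have hver := isVersal_of_surjective_infinitesimalAction A (fun _ : Fin 1 => boundaryRep p q r s o 𝔽)
    (hA ▸ surjective_infinitesimalAction_sum o)
  simpa using hB.2 1 _ hver
end
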